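/- arXiv:1409.0711 — 3 statements merged into one kernel-verified Lean document; each statement's English description precedes it below -/
import Mathlib

section
/- Let G = (V,E) be a connected simple graph on N ≥ 2 vertices, Ψ a potential on V and β > 0. Let ρ* be the Gibbs distribution and let ρ(t) : [0,∞) → M be a solution of Fokker–Planck equation II with initial value ρ⁰ ∈ M. Then for all t ≥ 0: ||ρ(t)/ρ* − 1||²_{2,ρ*} ≤ ||ρ⁰/ρ* − 1||²_{2,ρ*} · e^{−Ct}, where C = β λ₂ · (min_i ρ*_i)/(max_i ρ*_i) and λ₂ is the spectral gap of G. In particular ρ(t) converges exponentially to ρ* in the Euclidean metric of ℝ^N as t → ∞. -/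
/-!
STATEMENT 1: Exponential convergence in weighted L² norm for solutions of
Fokker–Planck equation II, with explicit rate `C = β λ₂ (min ρ*)/(max ρ*)`.
-/

open Finset Real

/-- `ρ` is a positive probability distribution on the `N` vertices. -/
def IsProbDist {N : ℕ} (ρ : Fin N → ℝ) : Prop :=
  (∀ i, 0 < ρ i) ∧ ∑ i, ρ i = 1

/-- The Gibbs distribution `ρ*_i = e^{-Ψ_i/β} / Σ_j e^{-Ψ_j/β}`. -/
noncomputable def gibbs {N : ℕ} (Ψ : Fin N → ℝ) (β : ℝ) (i : Fin N) : ℝ :=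
  Real.exp (-Ψ i / β) / ∑ j, Real.exp (-Ψ j / β)

/-- Right hand side of Fokker–Planck equation II (`Ψ̄_i = Ψ_i + β log ρ_i`). -/
noncomputable def fpe2RHS {N : ℕ} (G : SimpleGraph (Fin N)) [DecidableRel G.Adj]
    (Ψ : Fin N → ℝ) (β : ℝ) (ρ : Fin N → ℝ) (i : Fin N) : ℝ :=
  (∑ j, if G.Adj i j ∧ Ψ i + β * Real.log (ρ i) < Ψ j + β * Real.log (ρ j) then
      ((Ψ j + β * Real.log (ρ j)) - (Ψ i + β * Real.log (ρ i))) * ρ j else 0)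
  + (∑ j, if G.Adj i j ∧ Ψ j + β * Real.log (ρ j) < Ψ i + β * Real.log (ρ i) then
      ((Ψ j + β * Real.log (ρ j)) - (Ψ i + β * Real.log (ρ i))) * ρ i else 0)

/-- `ρ : [0,∞) → M` is a solution of Fokker–Planck equation II. -/
def IsFPE2Sol {N : ℕ} (G : SimpleGraph (Fin N)) [DecidableRel G.Adj]
    (Ψ : Fin N → ℝ) (β : ℝ) (ρ : ℝ → Fin N → ℝ) : Prop :=
  (∀ t, 0 ≤ t → IsProbDist (ρ t)) ∧
  ∀ t, 0 ≤ t → ∀ i,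
    HasDerivWithinAt (fun s => ρ s i) (fpe2RHS G Ψ β (ρ t) i) (Set.Ici 0) t

/-- Squared weighted `L²` distance `‖ν/μ - 1‖²_{2,μ}`. -/
noncomputable def wL2sq {N : ℕ} (ν μ : Fin N → ℝ) : ℝ :=
  ∑ i, (ν i / μ i - 1) ^ 2 * μ i

/-- The eigenvalues of a real symmetric matrix, sorted in nondecreasing order
(with multiplicity).  For a non-Hermitian matrix this returns the junk value `0`. -/
noncomputable def sortedEigs {N : ℕ} (A : Matrix (Fin N) (Fin N) ℝ) : Fin N → ℝ :=
  if h : A.IsHermitian then h.eigenvalues ∘ Tuple.sort h.eigenvalues else 0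

open Matrix in
/-- Parseval's identity in an orthonormal eigenbasis of a real symmetric matrix. -/
lemma Matrix.IsHermitian.sum_dotProduct_eigenvectorBasis_mul {n : Type*} [Fintype n]
    [DecidableEq n] {A : Matrix n n ℝ} (hA : A.IsHermitian) (x y : n → ℝ) :
    ∑ i, (⇑(hA.eigenvectorBasis i) ⬝ᵥ x) * (⇑(hA.eigenvectorBasis i) ⬝ᵥ y) = x ⬝ᵥ y := by
  have h := hA.eigenvectorBasis.sum_inner_mul_inner (WithLp.toLp 2 x) (WithLp.toLp 2 y)
  simpa [EuclideanSpace.inner_eq_star_dotProduct, dotProduct_comm] using h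

open Matrix in
lemma Matrix.IsHermitian.eigenvectorBasis_dotProduct_mulVec {n : Type*} [Fintype n]
    [DecidableEq n] {A : Matrix n n ℝ} (hA : A.IsHermitian) (i : n) (x : n → ℝ) :
    ⇑(hA.eigenvectorBasis i) ⬝ᵥ (A *ᵥ x) =
      hA.eigenvalues i * (⇑(hA.eigenvectorBasis i) ⬝ᵥ x) := by
  have hT : Aᵀ = A := by simpa using hA.eq
  rw [dotProduct_mulVec, ← mulVec_transpose, hT, hA.mulVec_eigenvectorBasis, smul_dotProduct,
    smul_eq_mul]

open Matrix in
/-- A symmetric matrix's quadratic form, diagonalised in its eigenbasis. -/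
lemma Matrix.IsHermitian.dotProduct_mulVec_eq_sum_eigenvalues {n : Type*} [Fintype n]
    [DecidableEq n] {A : Matrix n n ℝ} (hA : A.IsHermitian) (x : n → ℝ) :
    x ⬝ᵥ (A *ᵥ x) = ∑ i, hA.eigenvalues i * (⇑(hA.eigenvectorBasis i) ⬝ᵥ x) ^ 2 := by
  rw [← hA.sum_dotProduct_eigenvectorBasis_mul]
  refine Finset.sum_congr rfl fun i _ => ?_
  rw [hA.eigenvectorBasis_dotProduct_mulVec]
  ring

lemma sortedEigs_one_le {N : ℕ} (hN : 1 < N) {A : Matrix (Fin N) (Fin N) ℝ}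
    (hA : A.IsHermitian) {i : Fin N} (hi : i ≠ Tuple.sort hA.eigenvalues ⟨0, zero_lt_one.trans hN⟩) :
    sortedEigs A ⟨1, hN⟩ ≤ hA.eigenvalues i := by
  rw [sortedEigs, dif_pos hA]
  obtain ⟨k, rfl⟩ := (Tuple.sort hA.eigenvalues).surjective i
  refine Tuple.monotone_sort hA.eigenvalues ?_
  rw [Fin.le_def]
  by_contra! hk
  exact hi (congrArg _ (Fin.ext (by simpa using hk)))

/-- The spectral gap of a connected graph is positive. -/
lemma sortedEigs_lapMatrix_one_pos {N : ℕ} (hN : 1 < N) (G : SimpleGraph (Fin N))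
    [DecidableRel G.Adj] (hG : G.Connected) :
    0 < sortedEigs (G.lapMatrix ℝ) ⟨1, hN⟩ := by
  have hA := G.isHermitian_lapMatrix ℝ
  set σ := Tuple.sort hA.eigenvalues
  have hpos := (G.posSemidef_lapMatrix ℝ).eigenvalues_nonneg
  have hmono : Monotone (hA.eigenvalues ∘ σ) := Tuple.monotone_sort _
  have hs : sortedEigs (G.lapMatrix ℝ) ⟨1, hN⟩ = hA.eigenvalues (σ ⟨1, hN⟩) := by
    rw [sortedEigs, dif_pos hA]; rfl
  rw [hs]
  refine lt_of_le_of_ne (hpos _) fun h1 => ?_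
  have h0 : hA.eigenvalues (σ ⟨0, zero_lt_one.trans hN⟩) = 0 :=
    le_antisymm (h1 ▸ hmono (by simp [Fin.le_def])) (hpos _)
  have hconst : ∀ i, hA.eigenvalues i = 0 →
      ∃ c : ℝ, hA.eigenvectorBasis i = WithLp.toLp 2 fun _ => c := by
    intro i hi
    have hk := hA.mulVec_eigenvectorBasis i
    rw [hi, zero_smul, G.lapMatrix_mulVec_eq_zero_iff_forall_reachable] at hk
    refine ⟨hA.eigenvectorBasis i ⟨0, zero_lt_one.trans hN⟩, ?_⟩
    ext j
    exact hk _ _ (hG.preconnected _ _)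
  obtain ⟨c, hc⟩ := hconst _ h0
  obtain ⟨d, hd⟩ := hconst _ h1.symm
  have hne : σ ⟨0, zero_lt_one.trans hN⟩ ≠ σ ⟨1, hN⟩ := by simp [σ.injective.eq_iff]
  have horth : inner ℝ (hA.eigenvectorBasis (σ ⟨0, zero_lt_one.trans hN⟩))
      (hA.eigenvectorBasis (σ ⟨1, hN⟩)) = 0 := hA.eigenvectorBasis.orthonormal.2 hne
  have hc0 := hA.eigenvectorBasis.orthonormal.ne_zero (σ ⟨0, zero_lt_one.trans hN⟩)
  have hd0 := hA.eigenvectorBasis.orthonormal.ne_zero (σ ⟨1, hN⟩)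
  rw [hc] at horth hc0
  rw [hd] at horth hd0
  have hN0 : N ≠ 0 := by omega
  have : c = 0 ∨ d = 0 := by
    simpa [EuclideanSpace.inner_eq_star_dotProduct, dotProduct, hN0, or_comm] using horth
  rcases this with rfl | rfl
  · exact hc0 rfl
  · exact hd0 rfl

open Matrix in
/-- Poincaré inequality: on mean-zero vectors the Dirichlet form dominates the spectral gap. -/
lemma sortedEigs_lapMatrix_one_mul_le {N : ℕ} (hN : 1 < N) (G : SimpleGraph (Fin N))
    [DecidableRel G.Adj] (hG : G.Connected) (v : Fin N → ℝ) (hv : ∑ i, v i = 0) :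
    sortedEigs (G.lapMatrix ℝ) ⟨1, hN⟩ * ∑ i, v i ^ 2 ≤
      (∑ i, ∑ j, if G.Adj i j then (v i - v j) ^ 2 else 0) / 2 := by
  have hA := G.isHermitian_lapMatrix ℝ
  set l := sortedEigs (G.lapMatrix ℝ) ⟨1, hN⟩ with hl
  have hlpos : 0 < l := sortedEigs_lapMatrix_one_pos hN G hG
  set k := Tuple.sort hA.eigenvalues ⟨0, zero_lt_one.trans hN⟩ with hk
  let one : Fin N → ℝ := fun _ => 1
  have hone : ∀ i, i ≠ k → ⇑(hA.eigenvectorBasis i) ⬝ᵥ one = 0 := by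
    intro i hi
    have h := hA.eigenvectorBasis_dotProduct_mulVec i one
    rw [G.lapMatrix_mulVec_const_eq_zero, dotProduct_zero] at h
    exact (mul_eq_zero.1 h.symm).resolve_left
      (hlpos.trans_le (sortedEigs_one_le hN hA hi)).ne'
  have hkone : ∀ x, (⇑(hA.eigenvectorBasis k) ⬝ᵥ one) * (⇑(hA.eigenvectorBasis k) ⬝ᵥ x) =
      one ⬝ᵥ x := by
    intro x
    rw [← hA.sum_dotProduct_eigenvectorBasis_mul one x, Finset.sum_eq_single k]
    · intro i _ hi
      rw [hone i hi, zero_mul]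
    · simp
  have hkv : ⇑(hA.eigenvectorBasis k) ⬝ᵥ v = 0 := by
    have h1 := hkone one
    have h2 := hkone v
    have h3 : one ⬝ᵥ v = 0 := by simpa [one, dotProduct] using hv
    have h4 : one ⬝ᵥ one = N := by simp [one, dotProduct]
    rw [h3] at h2
    refine (mul_eq_zero.1 h2).resolve_left fun h => ?_
    rw [h, zero_mul, h4] at h1
    have : N = 0 := by exact_mod_cast h1.symm
    omega
  rw [← G.lapMatrix_toLinearMap₂' (R := ℝ), toLinearMap₂'_apply',
    hA.dotProduct_mulVec_eq_sum_eigenvalues]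
  have hn : ∑ i, v i ^ 2 = ∑ i, (⇑(hA.eigenvectorBasis i) ⬝ᵥ v) ^ 2 := by
    simpa [dotProduct, sq] using (hA.sum_dotProduct_eigenvectorBasis_mul v v).symm
  rw [hn, Finset.mul_sum]
  refine Finset.sum_le_sum fun i _ => ?_
  by_cases hi : i = k
  · simp [hi, hkv]
  · exact mul_le_mul_of_nonneg_right (sortedEigs_one_le hN hA hi) (sq_nonneg _)

lemma isProbDist_gibbs {N : ℕ} (hN : 1 < N) (Ψ : Fin N → ℝ) (β : ℝ) :
    IsProbDist (gibbs Ψ β) := by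
  have : Nonempty (Fin N) := ⟨⟨0, zero_lt_one.trans hN⟩⟩
  have hK : 0 < ∑ j, Real.exp (-Ψ j / β) :=
    Finset.sum_pos (fun _ _ => Real.exp_pos _) Finset.univ_nonempty
  refine ⟨fun i => div_pos (Real.exp_pos _) hK, ?_⟩
  simp only [gibbs]
  rw [← Finset.sum_div, div_self hK.ne']

/-- The free-energy potential differences are differences of `β log (ρ / ρ*)`. -/
lemma add_mul_log_sub {N : ℕ} (Ψ : Fin N → ℝ) {β : ℝ} (hβ : 0 < β) {ρ : Fin N → ℝ}
    (hρ : ∀ i, 0 < ρ i) (i j : Fin N) :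
    (Ψ j + β * Real.log (ρ j)) - (Ψ i + β * Real.log (ρ i)) =
      β * (Real.log (ρ j / gibbs Ψ β j) - Real.log (ρ i / gibbs Ψ β i)) := by
  have hK : 0 < ∑ j, Real.exp (-Ψ j / β) :=
    Finset.sum_pos (fun _ _ => Real.exp_pos _) ⟨i, Finset.mem_univ i⟩
  have h : ∀ k, Real.log (ρ k / gibbs Ψ β k) =
      Real.log (ρ k) + Ψ k / β + Real.log (∑ j, Real.exp (-Ψ j / β)) := by
    intro k
    rw [gibbs, Real.log_div (hρ k).ne' (div_pos (Real.exp_pos _) hK).ne',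
      Real.log_div (Real.exp_pos _).ne' hK.ne', Real.log_exp]
    ring
  rw [h, h]
  field_simp
  ring

lemma sub_sq_le_sub_mul_log_sub_mul {a b : ℝ} (ha : 0 < a) (hab : a ≤ b) :
    (a - b) ^ 2 ≤ (b - a) * ((Real.log b - Real.log a) * b) := by
  have hb := ha.trans_le hab
  have h := Real.log_le_sub_one_of_pos (div_pos ha hb)
  rw [Real.log_div ha.ne' hb.ne'] at h
  have h2 : b - a ≤ (Real.log b - Real.log a) * b := by
    have : (1 - a / b) * b ≤ (Real.log b - Real.log a) * b :=
      mul_le_mul_of_nonneg_right (by linarith) hb.le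
    rwa [sub_mul, div_mul_cancel₀ _ hb.ne', one_mul] at this
  nlinarith

/-- Entropy-type dissipation estimate: testing the right-hand side of the equation against
`ρ / ρ* - 1` is controlled by the Dirichlet form of `ρ / ρ*`. -/
lemma sum_mul_fpe2RHS_le {N : ℕ} (G : SimpleGraph (Fin N)) [DecidableRel G.Adj]
    (Ψ : Fin N → ℝ) {β : ℝ} (hβ : 0 < β) {ρ : Fin N → ℝ} (hρ : ∀ i, 0 < ρ i) {m : ℝ}
    (hm : ∀ i, m ≤ gibbs Ψ β i) (hgpos : ∀ i, 0 < gibbs Ψ β i) :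
    ∑ i, (ρ i / gibbs Ψ β i - 1) * fpe2RHS G Ψ β ρ i ≤
      -(β * m) * ((∑ i, ∑ j, if G.Adj i j then
        (ρ i / gibbs Ψ β i - ρ j / gibbs Ψ β j) ^ 2 else 0) / 2) := by
  set h : Fin N → ℝ := fun i => ρ i / gibbs Ψ β i with hh
  have hpos : ∀ i, 0 < h i := fun i => div_pos (hρ i) (hgpos i)
  set E : Fin N → ℝ := fun i => Ψ i + β * Real.log (ρ i) with hE
  have hEsub : ∀ i j, E j - E i = β * (Real.log (h j) - Real.log (h i)) :=
    fun i j => add_mul_log_sub Ψ hβ hρ i j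
  have hElt : ∀ i j, E i < E j ↔ h i < h j := by
    intro i j
    rw [← sub_pos, hEsub, mul_pos_iff_of_pos_left hβ, sub_pos,
      Real.log_lt_log_iff (hpos i) (hpos j)]
  let F : Fin N → Fin N → ℝ := fun i j =>
    if G.Adj i j ∧ E i < E j then (E j - E i) * ρ j else 0
  have hrhs : ∀ i, fpe2RHS G Ψ β ρ i = ∑ j, F i j - ∑ j, F j i := by
    intro i
    rw [fpe2RHS, sub_eq_add_neg, ← Finset.sum_neg_distrib]
    congr 1
    refine Finset.sum_congr rfl fun j _ => ?_
    simp only [F, G.adj_comm j i]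
    split_ifs <;> ring
  have hflux : ∀ i j, (h i - h j) * F i j + (h j - h i) * F j i ≤
      -(β * m) * (if G.Adj i j then (h i - h j) ^ 2 else 0) := by
    have key : ∀ i j, G.Adj i j → h i ≤ h j →
        (h i - h j) * F i j + (h j - h i) * F j i ≤ -(β * m) * (h i - h j) ^ 2 := by
      intro i j hij hle
      have h1 : F j i = 0 := if_neg fun hc => absurd ((hElt j i).1 hc.2) (not_lt.2 hle)
      rw [h1, mul_zero, add_zero]
      rcases hle.lt_or_eq with hlt | heq
      · have h2 : F i j = (E j - E i) * ρ j := if_pos ⟨hij, (hElt i j).2 hlt⟩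
        have h3 : ρ j = h j * gibbs Ψ β j := (div_mul_cancel₀ _ (hgpos j).ne').symm
        have h4 := sub_sq_le_sub_mul_log_sub_mul (hpos i) hle
        rw [h2, hEsub, h3]
        have h5 := mul_le_mul_of_nonneg_right (hm j) (sq_nonneg (h i - h j))
        have h6 := mul_le_mul_of_nonneg_left h4 (hgpos j).le
        have h7 := mul_le_mul_of_nonneg_left (h5.trans h6) hβ.le
        linarith
      · simp [heq]
    intro i j
    by_cases hij : G.Adj i j
    · rw [if_pos hij]
      rcases le_total (h i) (h j) with hle | hle
      · exact key i j hij hle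
      · have := key j i hij.symm hle
        linarith [sub_sq_comm (h i) (h j)]
    · have h1 : F i j = 0 := if_neg fun hc => hij hc.1
      have h2 : F j i = 0 := if_neg fun hc => hij hc.1.symm
      simp [h1, h2, hij]
  have hsum : ∑ i, (h i - 1) * fpe2RHS G Ψ β ρ i =
      (∑ i, ∑ j, ((h i - h j) * F i j + (h j - h i) * F j i)) / 2 := by
    have h1 : ∑ i, ∑ j, (h j - h i) * F j i = ∑ i, ∑ j, (h i - h j) * F i j := Finset.sum_comm
    have h2 : ∑ i, ∑ j, (h i - 1) * F j i = ∑ i, ∑ j, (h j - 1) * F i j := Finset.sum_comm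
    simp only [Finset.sum_add_distrib]
    rw [h1]
    simp only [hrhs, mul_sub, Finset.mul_sum, Finset.sum_sub_distrib]
    rw [h2, add_self_div_two]
    simp only [← Finset.sum_sub_distrib]
    refine Finset.sum_congr rfl fun i _ => Finset.sum_congr rfl fun j _ => ?_
    ring
  rw [hsum, mul_div_assoc', Finset.mul_sum]
  simp only [Finset.mul_sum]
  gcongr with i _ j _
  exact hflux i j

/-- The weighted distance is at most the unweighted variance times the largest weight. -/
lemma wL2sq_le_mul_sum_sq {N : ℕ} {ρ μ : Fin N → ℝ} (hρ : IsProbDist ρ) (hμ : IsProbDist μ)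
    {M : ℝ} (hM : ∀ i, μ i ≤ M) (a : ℝ) :
    wL2sq ρ μ ≤ M * ∑ i, (ρ i / μ i - a) ^ 2 := by
  have h1 : ∑ i, (ρ i / μ i - a) ^ 2 * μ i = wL2sq ρ μ + (1 - a) ^ 2 := by
    have h2 : ∀ i, (ρ i / μ i - a) ^ 2 * μ i =
        (ρ i / μ i - 1) ^ 2 * μ i + (2 * (1 - a) * (ρ i - μ i) + (1 - a) ^ 2 * μ i) := by
      intro i
      have := (hμ.1 i).ne'
      field_simp
      ring
    simp only [h2, Finset.sum_add_distrib, ← Finset.mul_sum, Finset.sum_sub_distrib, hρ.2, hμ.2,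
      wL2sq]
    ring
  have h3 : ∑ i, (ρ i / μ i - a) ^ 2 * μ i ≤ M * ∑ i, (ρ i / μ i - a) ^ 2 := by
    rw [Finset.mul_sum]
    refine Finset.sum_le_sum fun i _ => ?_
    rw [mul_comm]
    exact mul_le_mul_of_nonneg_right (hM i) (sq_nonneg _)
  linarith [sq_nonneg (1 - a)]

lemma wL2sq_nonneg {N : ℕ} (ν : Fin N → ℝ) {μ : Fin N → ℝ} (hμ : ∀ i, 0 < μ i) :
    0 ≤ wL2sq ν μ :=
  Finset.sum_nonneg fun i _ => mul_nonneg (sq_nonneg _) (hμ i).le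

/-- The differential inequality behind the decay of the weighted distance. -/
lemma sum_mul_fpe2RHS_le_wL2sq {N : ℕ} (hN : 1 < N) (G : SimpleGraph (Fin N))
    [DecidableRel G.Adj] (hG : G.Connected) (Ψ : Fin N → ℝ) {β : ℝ} (hβ : 0 < β)
    {ρ : Fin N → ℝ} (hρ : IsProbDist ρ) {m M : ℝ} (hm0 : 0 ≤ m) (hM0 : 0 < M)
    (hm : ∀ i, m ≤ gibbs Ψ β i) (hM : ∀ i, gibbs Ψ β i ≤ M) :
    ∑ i, (ρ i / gibbs Ψ β i - 1) * fpe2RHS G Ψ β ρ i ≤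
      -(β * sortedEigs (G.lapMatrix ℝ) ⟨1, hN⟩ * (m / M)) * wL2sq ρ (gibbs Ψ β) := by
  have hμ := isProbDist_gibbs hN Ψ β
  have hl := sortedEigs_lapMatrix_one_pos hN G hG
  set a : ℝ := (∑ i, ρ i / gibbs Ψ β i) / N with ha
  have hmean : ∑ i, (ρ i / gibbs Ψ β i - a) = 0 := by
    have : (N : ℝ) ≠ 0 := by positivity
    simp [Finset.sum_sub_distrib, ha, mul_div_cancel₀ _ this]
  have hP := sortedEigs_lapMatrix_one_mul_le hN G hG _ hmean
  simp only [sub_sub_sub_cancel_right] at hP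
  have hD := sum_mul_fpe2RHS_le G Ψ hβ hρ.1 hm hμ.1
  have hV := wL2sq_le_mul_sum_sq hρ hμ hM a
  rw [← div_le_iff₀' hM0] at hV
  have h1 := mul_le_mul_of_nonneg_left
    ((mul_le_mul_of_nonneg_left hV hl.le).trans hP) (mul_nonneg hβ.le hm0)
  refine hD.trans ?_
  refine le_of_eq_of_le (neg_mul _ _) ((neg_le_neg h1).trans_eq ?_)
  ring

lemma hasDerivWithinAt_wL2sq {N : ℕ} {ρ : ℝ → Fin N → ℝ} {μ ρ' : Fin N → ℝ}
    (hμ : ∀ i, 0 < μ i) {s : Set ℝ} {t : ℝ}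
    (h : ∀ i, HasDerivWithinAt (fun u => ρ u i) (ρ' i) s t) :
    HasDerivWithinAt (fun u => wL2sq (ρ u) μ) (2 * ∑ i, (ρ t i / μ i - 1) * ρ' i) s t := by
  unfold wL2sq
  rw [Finset.mul_sum]
  refine HasDerivWithinAt.fun_sum fun i _ => ?_
  have hd := ((((h i).div_const (μ i)).sub_const 1).fun_pow 2).mul_const (μ i)
  refine hd.congr_deriv ?_
  rw [mul_assoc, div_mul_cancel₀ _ (hμ i).ne']
  norm_num
  ring

/-- Grönwall's inequality for linear decay on `[0, ∞)`. -/
lemma le_mul_exp_of_hasDerivWithinAt_le {f f' : ℝ → ℝ} {c : ℝ}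
    (hf : ∀ t, 0 ≤ t → HasDerivWithinAt f (f' t) (Set.Ici 0) t)
    (hf' : ∀ t, 0 ≤ t → f' t ≤ -c * f t) {t : ℝ} (ht : 0 ≤ t) :
    f t ≤ f 0 * Real.exp (-c * t) := by
  have hd : ∀ s, 0 ≤ s → HasDerivWithinAt (fun u => f u * Real.exp (c * u))
      (f' s * Real.exp (c * s) + f s * (Real.exp (c * s) * c)) (Set.Ici 0) s := by
    intro s hs
    have h1 : HasDerivAt (fun u => Real.exp (c * u)) (Real.exp (c * s) * c) s := by
      simpa using ((hasDerivAt_id s).const_mul c).exp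
    exact (hf s hs).mul h1.hasDerivWithinAt
  have hanti : AntitoneOn (fun u => f u * Real.exp (c * u)) (Set.Ici 0) := by
    refine antitoneOn_of_hasDerivWithinAt_nonpos (convex_Ici 0)
      (fun s hs => (hd s hs).continuousWithinAt)
      (fun s hs => (hd s (interior_subset hs)).mono interior_subset) fun s hs => ?_
    have h := mul_le_mul_of_nonneg_right (hf' s (interior_subset hs)) (Real.exp_pos (c * s)).le
    linarith
  have h := hanti Set.self_mem_Ici ht ht
  simp only [mul_zero, Real.exp_zero, mul_one] at h
  rwa [neg_mul, Real.exp_neg, ← div_eq_mul_inv, le_div_iff₀ (Real.exp_pos _)]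

/-- Convergence in the weighted distance implies convergence. -/
lemma tendsto_of_tendsto_wL2sq {N : ℕ} {α : Type*} {l : Filter α} {ρ : α → Fin N → ℝ}
    {μ : Fin N → ℝ} (hμ : ∀ i, 0 < μ i)
    (h : Filter.Tendsto (fun t => wL2sq (ρ t) μ) l (nhds 0)) :
    Filter.Tendsto ρ l (nhds μ) := by
  rw [tendsto_pi_nhds]
  intro i
  have hi : Filter.Tendsto (fun t => (ρ t i - μ i) ^ 2) l (nhds 0) := by
    have hb : Filter.Tendsto (fun t => μ i * wL2sq (ρ t) μ) l (nhds 0) := by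
      simpa using h.const_mul (μ i)
    refine squeeze_zero (fun t => sq_nonneg _) (fun t => ?_) hb
    have h1 : (ρ t i / μ i - 1) ^ 2 * μ i ≤ wL2sq (ρ t) μ :=
      Finset.single_le_sum (f := fun i => (ρ t i / μ i - 1) ^ 2 * μ i)
        (fun j _ => mul_nonneg (sq_nonneg _) (hμ j).le) (Finset.mem_univ i)
    have h2 := mul_le_mul_of_nonneg_left h1 (hμ i).le
    refine le_of_eq_of_le ?_ h2
    have := (hμ i).ne'
    field_simp
  have habs : Filter.Tendsto (fun t => |ρ t i - μ i|) l (nhds 0) := by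
    simpa [Real.sqrt_sq_eq_abs] using hi.sqrt
  rw [tendsto_iff_dist_tendsto_zero]
  simpa [Real.dist_eq] using habs

theorem fpe2_exponential_convergence {N : ℕ} (hN : 2 ≤ N)
    (G : SimpleGraph (Fin N)) [DecidableRel G.Adj] (hG : G.Connected)
    (Ψ : Fin N → ℝ) (β : ℝ) (hβ : 0 < β)
    (ρ : ℝ → Fin N → ℝ) (ρ0 : Fin N → ℝ) (hρ0 : IsProbDist ρ0)
    (hsol : IsFPE2Sol G Ψ β ρ) (hinit : ρ 0 = ρ0) :
    (∀ t, 0 ≤ t →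
      wL2sq (ρ t) (gibbs Ψ β) ≤ wL2sq ρ0 (gibbs Ψ β) *
        Real.exp (-(β * sortedEigs (G.lapMatrix ℝ) ⟨1, by omega⟩ *
          ((⨅ i, gibbs Ψ β i) / (⨆ i, gibbs Ψ β i))) * t)) ∧
    Filter.Tendsto ρ Filter.atTop (nhds (gibbs Ψ β)) := by
  have : Nonempty (Fin N) := ⟨⟨0, by omega⟩⟩
  have hμ := isProbDist_gibbs hN Ψ β
  have hm : ∀ i, ⨅ i, gibbs Ψ β i ≤ gibbs Ψ β i := ciInf_le (Set.finite_range _).bddBelow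
  have hM : ∀ i, gibbs Ψ β i ≤ ⨆ i, gibbs Ψ β i := le_ciSup (Set.finite_range _).bddAbove
  have hm0 : 0 < ⨅ i, gibbs Ψ β i := by
    obtain ⟨i, hi⟩ := exists_eq_ciInf_of_finite (f := gibbs Ψ β)
    rw [← hi]
    exact hμ.1 i
  have hM0 : 0 < ⨆ i, gibbs Ψ β i := (hμ.1 ⟨0, by omega⟩).trans_le (hM _)
  have hl := sortedEigs_lapMatrix_one_pos hN G hG
  set c := β * sortedEigs (G.lapMatrix ℝ) ⟨1, by omega⟩ *
    ((⨅ i, gibbs Ψ β i) / (⨆ i, gibbs Ψ β i)) with hc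
  have hc0 : 0 < c := mul_pos (mul_pos hβ hl) (div_pos hm0 hM0)
  have hdecay : ∀ t, 0 ≤ t →
      wL2sq (ρ t) (gibbs Ψ β) ≤ wL2sq ρ0 (gibbs Ψ β) * Real.exp (-c * t) := by
    intro t ht
    rw [← hinit]
    refine le_mul_exp_of_hasDerivWithinAt_le (f := fun s => wL2sq (ρ s) (gibbs Ψ β))
      (fun s hs => hasDerivWithinAt_wL2sq hμ.1 (hsol.2 s hs)) (fun s hs => ?_) ht
    have h1 := sum_mul_fpe2RHS_le_wL2sq hN G hG Ψ hβ (hsol.1 s hs) hm0.le hM0 hm hM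
    have h2 := mul_nonneg hc0.le (wL2sq_nonneg (ρ s) hμ.1)
    linarith
  refine ⟨hdecay, tendsto_of_tendsto_wL2sq hμ.1 ?_⟩
  have hexp : Filter.Tendsto (fun t => wL2sq ρ0 (gibbs Ψ β) * Real.exp (-c * t)) Filter.atTop
      (nhds 0) := by
    have h1 : Filter.Tendsto (fun t : ℝ => -c * t) Filter.atTop Filter.atBot :=
      Filter.tendsto_id.const_mul_atTop_of_neg (neg_lt_zero.2 hc0)
    simpa using (Real.tendsto_exp_atBot.comp h1).const_mul (wL2sq ρ0 (gibbs Ψ β))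
  refine squeeze_zero' (Filter.Eventually.of_forall fun t => wL2sq_nonneg _ hμ.1) ?_ hexp
  filter_upwards [Filter.eventually_ge_atTop 0] with t ht using hdecay t ht
end

section
/- Let G = (V,E) be a connected simple graph on N ≥ 2 vertices, Ψ a potential on V, β > 0 and ρ⁰ ∈ M. Set M₀ = max{e^{2|Ψ_i|} : 1 ≤ i ≤ N}, ε₀ = 1, ε₁ = (1/2)·min{ ε₀/(1+(2M₀)^{1/β}), min_i ρ⁰_i }, and ε_ℓ = ε_{ℓ−1}/(1+(2M₀)^{1/β}) for ℓ = 2,...,N−1. Define B = { q ∈ M : Σ_{r=1}^ℓ q_{i_r} ≤ 1 − ε_ℓ for every ℓ ∈ {1,...,N−1} and all indices 1 ≤ i_1 < ... < i_ℓ ≤ N }. If ρ(t) : [0,∞) → M is the solution of Fokker–Planck equation I with initial value ρ⁰, then ρ(t) ∈ B for all t ≥ 0. -/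
/-!
STATEMENT 4: The solution of Fokker–Planck equation I stays in the compact
set B determined by the sequence ε_ℓ.
-/

open Finset Real

/-- Right hand side of Fokker–Planck equation I. -/
noncomputable def fpe1RHS {N : ℕ} (G : SimpleGraph (Fin N)) [DecidableRel G.Adj]
    (Ψ : Fin N → ℝ) (β : ℝ) (ρ : Fin N → ℝ) (i : Fin N) : ℝ :=
  (∑ j, if G.Adj i j ∧ Ψ i < Ψ j then
      ((Ψ j + β * Real.log (ρ j)) - (Ψ i + β * Real.log (ρ i))) * ρ j else 0)
  + (∑ j, if G.Adj i j ∧ Ψ j < Ψ i then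
      ((Ψ j + β * Real.log (ρ j)) - (Ψ i + β * Real.log (ρ i))) * ρ i else 0)
  + (∑ j, if G.Adj i j ∧ Ψ j = Ψ i then β * (ρ j - ρ i) else 0)

/-- `ρ : [0,∞) → M` is a solution of Fokker–Planck equation I. -/
def IsFPE1Sol {N : ℕ} (G : SimpleGraph (Fin N)) [DecidableRel G.Adj]
    (Ψ : Fin N → ℝ) (β : ℝ) (ρ : ℝ → Fin N → ℝ) : Prop :=
  (∀ t, 0 ≤ t → IsProbDist (ρ t)) ∧
  ∀ t, 0 ≤ t → ∀ i,
    HasDerivWithinAt (fun s => ρ s i) (fpe1RHS G Ψ β (ρ t) i) (Set.Ici 0) t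

/-- The sequence ε₀ = 1, ε₁ = (1/2) min(ε₀/(1+(2M₀)^{1/β}), ρmin),
ε_ℓ = ε_{ℓ-1}/(1+(2M₀)^{1/β}) for ℓ ≥ 2. -/
noncomputable def epsSeq (M₀ β ρmin : ℝ) : ℕ → ℝ
  | 0 => 1
  | 1 => (1 / 2) * min ((1 : ℝ) / (1 + (2 * M₀) ^ ((1 : ℝ) / β))) ρmin
  | (n + 2) => epsSeq M₀ β ρmin (n + 1) / (1 + (2 * M₀) ^ ((1 : ℝ) / β))

/-- The net flow into `i` along the edge `{i, j}` in Fokker–Planck equation I. -/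
noncomputable def fpe1Flux {N : ℕ} (G : SimpleGraph (Fin N)) [DecidableRel G.Adj]
    (Ψ : Fin N → ℝ) (β : ℝ) (ρ : Fin N → ℝ) (i j : Fin N) : ℝ :=
  (if G.Adj i j ∧ Ψ i < Ψ j then
      ((Ψ j + β * Real.log (ρ j)) - (Ψ i + β * Real.log (ρ i))) * ρ j else 0)
  + (if G.Adj i j ∧ Ψ j < Ψ i then
      ((Ψ j + β * Real.log (ρ j)) - (Ψ i + β * Real.log (ρ i))) * ρ i else 0)
  + (if G.Adj i j ∧ Ψ j = Ψ i then β * (ρ j - ρ i) else 0)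

lemma fpe1RHS_eq_sum_flux {N : ℕ} (G : SimpleGraph (Fin N)) [DecidableRel G.Adj]
    (Ψ : Fin N → ℝ) (β : ℝ) (ρ : Fin N → ℝ) (i : Fin N) :
    fpe1RHS G Ψ β ρ i = ∑ j, fpe1Flux G Ψ β ρ i j := by
  simp only [fpe1RHS, fpe1Flux, Finset.sum_add_distrib]

lemma fpe1Flux_antisymm {N : ℕ} (G : SimpleGraph (Fin N)) [DecidableRel G.Adj]
    (Ψ : Fin N → ℝ) (β : ℝ) (ρ : Fin N → ℝ) (i j : Fin N) :
    fpe1Flux G Ψ β ρ i j = -fpe1Flux G Ψ β ρ j i := by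
  by_cases h : G.Adj i j
  · have h' := h.symm
    rcases lt_trichotomy (Ψ i) (Ψ j) with hlt | heq | hgt
    · simp only [fpe1Flux, h, h', hlt, hlt.not_gt, hlt.ne, hlt.ne', and_self, and_false,
        if_true, if_false]
      ring
    · simp only [fpe1Flux, h, h', heq, lt_irrefl, and_self, and_false, if_true, if_false]
      ring
    · simp only [fpe1Flux, h, h', hgt, hgt.not_gt, hgt.ne, hgt.ne', and_self, and_false,
        if_true, if_false]
      ring
  · have h' : ¬ G.Adj j i := fun h' => h h'.symm
    simp [fpe1Flux, h, h']

lemma fpe1Flux_eq_zero_of_not_adj {N : ℕ} {G : SimpleGraph (Fin N)} [DecidableRel G.Adj]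
    {i j : Fin N} (h : ¬ G.Adj i j) (Ψ : Fin N → ℝ) (β : ℝ) (ρ : Fin N → ℝ) :
    fpe1Flux G Ψ β ρ i j = 0 := by
  simp [fpe1Flux, h]

lemma fpe1Flux_neg {N : ℕ} {G : SimpleGraph (Fin N)} [DecidableRel G.Adj]
    {Ψ : Fin N → ℝ} {β : ℝ} {ρ : Fin N → ℝ} {i j : Fin N} (h : G.Adj i j) (hβ : 0 < β)
    (hi : 0 < ρ i) (hj : 0 < ρ j) (hlt : ρ j < ρ i)
    (hpot : Ψ j + β * Real.log (ρ j) < Ψ i + β * Real.log (ρ i)) :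
    fpe1Flux G Ψ β ρ i j < 0 := by
  rcases lt_trichotomy (Ψ i) (Ψ j) with hΨ | hΨ | hΨ
  · simp only [fpe1Flux, h, hΨ, hΨ.not_gt, hΨ.ne', and_self, and_false, if_true, if_false,
      add_zero]
    exact mul_neg_of_neg_of_pos (sub_neg.2 hpot) hj
  · simp only [fpe1Flux, h, hΨ, lt_irrefl, and_self, and_false, if_true, if_false, zero_add]
    exact mul_neg_of_pos_of_neg hβ (sub_neg.2 hlt)
  · simp only [fpe1Flux, h, hΨ, hΨ.not_gt, hΨ.ne, and_self, and_false, if_true, if_false,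
      add_zero, zero_add]
    exact mul_neg_of_neg_of_pos (sub_neg.2 hpot) hi

lemma sum_sum_eq_zero_of_antisymm {ι : Type*} (S : Finset ι) (F : ι → ι → ℝ)
    (hF : ∀ i j, F i j = -F j i) : ∑ i ∈ S, ∑ j ∈ S, F i j = 0 := by
  have h : ∑ i ∈ S, ∑ j ∈ S, F i j = -∑ i ∈ S, ∑ j ∈ S, F i j := by
    conv_lhs => rw [Finset.sum_comm]
    simp only [← Finset.sum_neg_distrib]
    exact Finset.sum_congr rfl fun i _ => Finset.sum_congr rfl fun j _ => hF j i
  linarith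

lemma sum_fpe1RHS_eq_sum_flux_compl {N : ℕ} (G : SimpleGraph (Fin N)) [DecidableRel G.Adj]
    (Ψ : Fin N → ℝ) (β : ℝ) (ρ : Fin N → ℝ) (S : Finset (Fin N)) :
    ∑ i ∈ S, fpe1RHS G Ψ β ρ i = ∑ i ∈ S, ∑ j ∈ Sᶜ, fpe1Flux G Ψ β ρ i j := by
  have h := sum_sum_eq_zero_of_antisymm S _ (fpe1Flux_antisymm G Ψ β ρ)
  simp only [fpe1RHS_eq_sum_flux, ← Finset.sum_add_sum_compl S, Finset.sum_add_distrib, h,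
    zero_add]

lemma exists_adj_compl_of_connected {V : Type*} {G : SimpleGraph V} (hG : G.Connected)
    {S : Set V} {u v : V} (hu : u ∈ S) (hv : v ∉ S) : ∃ i ∈ S, ∃ j ∉ S, G.Adj i j := by
  obtain ⟨p⟩ := hG.preconnected u v
  obtain ⟨d, -, h1, h2⟩ := p.exists_boundary_dart S hu hv
  exact ⟨d.fst, h1, d.snd, h2, d.adj⟩

lemma epsSeq_pos {M β m : ℝ} (hM : 1 ≤ M) (hm : 0 < m) : ∀ n, 0 < epsSeq M β m n
  | 0 => by simp [epsSeq]
  | 1 => by rw [epsSeq]; positivity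
  | n + 2 => by
    have := epsSeq_pos (β := β) hM hm (n + 1)
    rw [epsSeq]; positivity

lemma epsSeq_succ_mul_le {M β m : ℝ} (hM : 1 ≤ M) (n : ℕ) :
    epsSeq M β m (n + 1) * (1 + (2 * M) ^ ((1 : ℝ) / β)) ≤ epsSeq M β m n := by
  have hK : 0 < 1 + (2 * M) ^ ((1 : ℝ) / β) := by positivity
  cases n with
  | zero =>
    have h := min_le_left ((1 : ℝ) / (1 + (2 * M) ^ ((1 : ℝ) / β))) m
    rw [le_div_iff₀ hK] at h
    simp only [epsSeq]
    linarith
  | succ n => rw [epsSeq, div_mul_cancel₀ _ hK.ne']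

lemma epsSeq_succ_le {M β m : ℝ} (hM : 1 ≤ M) (hm : 0 < m) (n : ℕ) :
    epsSeq M β m (n + 1) ≤ m := by
  induction n with
  | zero =>
    have h := min_le_right ((1 : ℝ) / (1 + (2 * M) ^ ((1 : ℝ) / β))) m
    simp only [epsSeq]
    linarith
  | succ n ih =>
    have h := epsSeq_succ_mul_le (β := β) (m := m) hM (n + 1)
    have hpos := epsSeq_pos (β := β) hM hm (n + 2)
    have hK : 0 < (2 * M) ^ ((1 : ℝ) / β) := by positivity
    nlinarith [mul_pos hpos hK]

lemma add_mul_log_lt_of_rpow_mul_le {M β a b x y : ℝ} (hβ : 0 < β)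
    (ha : Real.exp (2 * |a|) ≤ M) (hb : Real.exp (2 * |b|) ≤ M) (hy : 0 < y)
    (h : (2 * M) ^ ((1 : ℝ) / β) * y ≤ x) :
    b + β * Real.log y < a + β * Real.log x := by
  have hM : 0 < M := (Real.exp_pos _).trans_le ha
  have hla := (Real.le_log_iff_exp_le hM).2 ha
  have hlb := (Real.le_log_iff_exp_le hM).2 hb
  have hlog := Real.log_le_log (by positivity) h
  rw [Real.log_mul (by positivity) hy.ne', Real.log_rpow (by positivity),
    Real.log_mul two_ne_zero hM.ne'] at hlog
  have hmul := mul_le_mul_of_nonneg_left hlog hβ.le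
  have heq : β * (1 / β * (Real.log 2 + Real.log M) + Real.log y)
      = Real.log 2 + Real.log M + β * Real.log y := by
    field_simp
  have h2 : 0 < Real.log 2 := Real.log_pos one_lt_two
  linarith [neg_abs_le a, le_abs_self b]

lemma sum_fpe1RHS_neg_of_boundary {N : ℕ} {G : SimpleGraph (Fin N)} [DecidableRel G.Adj]
    (hG : G.Connected) {Ψ : Fin N → ℝ} {β : ℝ} (hβ : 0 < β) {M m : ℝ}
    (hM : ∀ i, Real.exp (2 * |Ψ i|) ≤ M) {q : Fin N → ℝ} (hq : IsProbDist q)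
    {S : Finset (Fin N)} (hS : S.Nonempty) (hSc : Sᶜ.Nonempty)
    (hsub : ∀ i ∈ S, ∑ k ∈ S.erase i, q k ≤ 1 - epsSeq M β m (S.card - 1))
    (hbd : ∑ k ∈ S, q k = 1 - epsSeq M β m S.card) :
    ∑ i ∈ S, fpe1RHS G Ψ β q i < 0 := by
  obtain ⟨u, hu⟩ := hS
  obtain ⟨v, hv⟩ := hSc
  have hM1 : 1 ≤ M := (Real.one_le_exp (by positivity)).trans (hM u)
  have hK : 1 < (2 * M) ^ ((1 : ℝ) / β) :=
    Real.one_lt_rpow (by linarith) (by positivity)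
  have hflux : ∀ i ∈ S, ∀ j ∈ Sᶜ, G.Adj i j → fpe1Flux G Ψ β q i j < 0 := by
    intro i hi j hj hij
    have hjle : q j ≤ epsSeq M β m S.card := by
      have h1 := Finset.single_le_sum (fun k _ => (hq.1 k).le) hj
      have h2 := Finset.sum_add_sum_compl S q
      linarith [hq.2]
    have hile : (2 * M) ^ ((1 : ℝ) / β) * q j ≤ q i := by
      have h1 := hsub i hi
      have h2 := Finset.add_sum_erase S q hi
      have h3 := epsSeq_succ_mul_le (β := β) (m := m) hM1 (S.card - 1)
      rw [Nat.sub_add_cancel (Finset.card_pos.2 ⟨i, hi⟩)] at h3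
      have h4 := mul_le_mul_of_nonneg_left hjle (zero_le_one.trans hK.le)
      linarith
    refine fpe1Flux_neg hij hβ (hq.1 i) (hq.1 j) ?_
      (add_mul_log_lt_of_rpow_mul_le hβ (hM i) (hM j) (hq.1 j) hile)
    nlinarith [hq.1 j]
  have hflux' : ∀ i ∈ S, ∀ j ∈ Sᶜ, fpe1Flux G Ψ β q i j ≤ 0 := by
    intro i hi j hj
    by_cases hij : G.Adj i j
    · exact (hflux i hi j hj hij).le
    · exact (fpe1Flux_eq_zero_of_not_adj hij Ψ β q).le
  obtain ⟨i, hi, j, hj, hij⟩ := exists_adj_compl_of_connected (S := (S : Set (Fin N))) hG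
    (Finset.mem_coe.2 hu) (fun h => Finset.mem_compl.1 hv (Finset.mem_coe.1 h))
  have hj' : j ∈ Sᶜ := Finset.mem_compl.2 fun h => hj (Finset.mem_coe.2 h)
  rw [sum_fpe1RHS_eq_sum_flux_compl]
  exact Finset.sum_neg' (fun i hi => Finset.sum_nonpos (hflux' i hi))
    ⟨i, hi, Finset.sum_neg' (hflux' i hi) ⟨j, hj', hflux i hi j hj' hij⟩⟩

lemma sum_le_one_sub_epsSeq {N : ℕ} {M β m : ℝ} (hM : 1 ≤ M) (hm : 0 < m) {q : Fin N → ℝ}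
    (hq : IsProbDist q) (hmq : ∀ i, m ≤ q i) {S : Finset (Fin N)} (hS : S.Nonempty)
    (hSc : Sᶜ.Nonempty) : ∑ i ∈ S, q i ≤ 1 - epsSeq M β m S.card := by
  obtain ⟨v, hv⟩ := hSc
  have h1 := Finset.single_le_sum (fun k _ => (hq.1 k).le) hv
  have h2 := Finset.sum_add_sum_compl S q
  have h3 := epsSeq_succ_le (β := β) hM hm (S.card - 1)
  rw [Nat.sub_add_cancel (Finset.card_pos.2 hS)] at h3
  linarith [hq.2, hmq v]

lemma eventually_le_of_hasDerivWithinAt_of_neg {f : ℝ → ℝ} {f' c x : ℝ}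
    (hf : HasDerivWithinAt f f' (Set.Ici x) x) (hle : f x ≤ c) (hneg : f x = c → f' < 0) :
    ∀ᶠ y in nhdsWithin x (Set.Ioi x), f y ≤ c := by
  rcases hle.lt_or_eq with hlt | heq
  · have hcont := hf.continuousWithinAt.mono Set.Ioi_subset_Ici_self
    exact (hcont.tendsto.eventually_lt_const hlt).mono fun y hy => hy.le
  · have hslope := (hf.mono Set.Ioi_subset_Ici_self).limsup_slope_le'
      Set.self_notMem_Ioi (hneg heq)
    filter_upwards [hslope, self_mem_nhdsWithin] with y hy hxy
    rw [slope_def_field, div_neg_iff] at hy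
    rcases hy with hy | hy
    · linarith [hy.2, Set.mem_Ioi.1 hxy]
    · linarith [hy.1]

theorem fpe1_solution_stays_in_B {N : ℕ} (hN : 2 ≤ N)
    (G : SimpleGraph (Fin N)) [DecidableRel G.Adj] (hG : G.Connected)
    (Ψ : Fin N → ℝ) (β : ℝ) (hβ : 0 < β)
    (ρ : ℝ → Fin N → ℝ) (ρ0 : Fin N → ℝ) (hρ0 : IsProbDist ρ0)
    (hsol : IsFPE1Sol G Ψ β ρ) (hinit : ρ 0 = ρ0) :
    ∀ t, 0 ≤ t → ∀ S : Finset (Fin N), 1 ≤ S.card → S.card ≤ N - 1 →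
      ∑ i ∈ S, ρ t i ≤
        1 - epsSeq (⨆ i, Real.exp (2 * |Ψ i|)) β (⨅ i, ρ0 i) S.card := by
  have hNpos : 0 < N := by omega
  have : Nonempty (Fin N) := ⟨⟨0, hNpos⟩⟩
  set M : ℝ := ⨆ i, Real.exp (2 * |Ψ i|)
  set m : ℝ := ⨅ i, ρ0 i
  have hM : ∀ i, Real.exp (2 * |Ψ i|) ≤ M := fun i =>
    le_ciSup (f := fun i => Real.exp (2 * |Ψ i|)) (Set.finite_range _).bddAbove i
  have hM1 : 1 ≤ M := (Real.one_le_exp (by positivity)).trans (hM ⟨0, hNpos⟩)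
  have hmle : ∀ i, m ≤ ρ0 i := fun i => ciInf_le (Set.finite_range _).bddBelow i
  have hm : 0 < m := by
    obtain ⟨i, hi⟩ := exists_eq_ciInf_of_finite (f := ρ0)
    exact (hρ0.1 i).trans_eq hi
  have hcompl : ∀ S : Finset (Fin N), S.card ≤ N - 1 → Sᶜ.Nonempty := fun S hS => by
    rw [← Finset.card_pos, Finset.card_compl, Fintype.card_fin]
    omega
  have hderiv : ∀ t, 0 ≤ t → ∀ S : Finset (Fin N), HasDerivWithinAt
      (fun s => ∑ i ∈ S, ρ s i) (∑ i ∈ S, fpe1RHS G Ψ β (ρ t) i) (Set.Ici 0) t :=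
    fun t ht S => HasDerivWithinAt.fun_sum fun i _ => hsol.2 t ht i
  intro T hT
  let B : Set ℝ := {t | ∀ S : Finset (Fin N), 1 ≤ S.card → S.card ≤ N - 1 →
    ∑ i ∈ S, ρ t i ≤ 1 - epsSeq M β m S.card}
  suffices hB : Set.Icc 0 T ⊆ B from hB ⟨hT, le_rfl⟩
  refine IsClosed.Icc_subset_of_forall_mem_nhdsWithin ?_ ?_ ?_
  · have heq : B ∩ Set.Icc 0 T = ⋂ S : Finset (Fin N), {t ∈ Set.Icc 0 T | 1 ≤ S.card →
        S.card ≤ N - 1 → ∑ i ∈ S, ρ t i ≤ 1 - epsSeq M β m S.card} := by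
      ext t
      simp only [B, Set.mem_inter_iff, Set.mem_iInter, Set.mem_ofPred_eq]
      exact ⟨fun h S => ⟨h.2, h.1 S⟩, fun h => ⟨fun S => (h S).2, (h ∅).1⟩⟩
    rw [heq]
    refine isClosed_iInter fun S => ?_
    by_cases hS : 1 ≤ S.card ∧ S.card ≤ N - 1
    · simp only [hS.1, hS.2, true_implies]
      refine isClosed_Icc.isClosed_le (fun t ht => ?_) continuousOn_const
      exact (hderiv t ht.1 S).continuousWithinAt.mono Set.Icc_subset_Ici_self
    · have : {t ∈ Set.Icc 0 T | 1 ≤ S.card → S.card ≤ N - 1 →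
          ∑ i ∈ S, ρ t i ≤ 1 - epsSeq M β m S.card} = Set.Icc 0 T :=
        Set.sep_eq_self_iff_mem_true.2 fun t _ h1 h2 => absurd ⟨h1, h2⟩ hS
      rw [this]
      exact isClosed_Icc
  · intro S h1 h2
    rw [hinit]
    exact sum_le_one_sub_epsSeq hM1 hm hρ0 hmle (Finset.card_pos.1 h1) (hcompl S h2)
  · rintro t ⟨htB, ht0, -⟩
    change ∀ᶠ s in nhdsWithin t (Set.Ioi t), ∀ S : Finset (Fin N), 1 ≤ S.card →
      S.card ≤ N - 1 → ∑ i ∈ S, ρ s i ≤ 1 - epsSeq M β m S.card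
    rw [Filter.eventually_all]
    intro S
    simp only [Filter.eventually_imp_distrib_left]
    intro h1 h2
    refine eventually_le_of_hasDerivWithinAt_of_neg
      ((hderiv t ht0 S).mono (Set.Ici_subset_Ici.2 ht0)) (htB S h1 h2) fun hbd => ?_
    refine sum_fpe1RHS_neg_of_boundary hG hβ hM (hsol.1 t ht0) (Finset.card_pos.1 h1)
      (hcompl S h2) (fun i hi => ?_) hbd
    rw [← Finset.card_erase_of_mem hi]
    rcases (S.erase i).eq_empty_or_nonempty with he | hne
    · simp [he, epsSeq]
    · exact htB _ (Finset.card_pos.2 hne) ((Finset.card_erase_le).trans h2)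
end

section
/- Let G = (V,E) be a connected simple graph on N ≥ 2 vertices, Ψ a potential on V, β > 0, and ρ* the Gibbs distribution. Let ρ(t) : [0,∞) → M be a solution of Fokker–Planck equation II and set f(t) = ρ(t)/ρ* (componentwise). Then for every t > 0: d/dt H(ρ(t)|ρ*) ≤ −(β/2) · (min_i ρ*_i / max_i ρ*_i) · E(f(t), log f(t)), where E is the Dirichlet form of G with respect to ρ*. -/
/-!
STATEMENT 8: Entropy dissipation bound for Fokker–Planck equation II in terms
of the Dirichlet form:
d/dt H(ρ(t)|ρ*) ≤ −(β/2)(min ρ*/max ρ*) E(f(t), log f(t)).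
-/

open Finset Real

/-- Relative entropy `H(ν|μ) = Σ_i ν_i log (ν_i/μ_i)`. -/
noncomputable def relEnt {N : ℕ} (ν μ : Fin N → ℝ) : ℝ :=
  ∑ i, ν i * Real.log (ν i / μ i)

/-- The Dirichlet form `E(f, log f)` of a graph with respect to the measure `μ`. -/
noncomputable def dirichletForm {N : ℕ} (G : SimpleGraph (Fin N)) [DecidableRel G.Adj]
    (μ f : Fin N → ℝ) : ℝ :=
  ∑ i, ∑ j, if G.Adj i j then
    (Real.log (f i) - Real.log (f j)) * (f i - f j) * μ i else 0

/-- Discrete integration by parts against an antisymmetric flux. -/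
theorem sum_mul_sum_of_antisymm {ι : Type*} [Fintype ι] (F : ι → ι → ℝ)
    (hF : ∀ i j, F i j = -F j i) (g : ι → ℝ) :
    ∑ i, (∑ j, F i j) * g i = (1 / 2) * ∑ i, ∑ j, F i j * (g i - g j) := by
  have h1 : ∑ i, (∑ j, F i j) * g i = ∑ i, ∑ j, F i j * g i := by
    simp_rw [Finset.sum_mul]
  have h2 : ∑ i, ∑ j, F i j * g j = -∑ i, ∑ j, F i j * g i := by
    rw [Finset.sum_comm]
    simp_rw [← Finset.sum_neg_distrib]
    refine Finset.sum_congr rfl fun i _ => Finset.sum_congr rfl fun j _ => ?_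
    rw [hF j i, neg_mul]
  simp_rw [mul_sub, Finset.sum_sub_distrib]
  rw [h1, h2]
  ring

theorem gibbs_pos {N : ℕ} (Ψ : Fin N → ℝ) (β : ℝ) (i : Fin N) : 0 < gibbs Ψ β i :=
  div_pos (Real.exp_pos _) (Finset.sum_pos (fun _ _ => Real.exp_pos _) ⟨i, Finset.mem_univ i⟩)

theorem log_gibbs {N : ℕ} (Ψ : Fin N → ℝ) (β : ℝ) (i : Fin N) :
    Real.log (gibbs Ψ β i) = -Ψ i / β - Real.log (∑ j, Real.exp (-Ψ j / β)) := by
  have h : 0 < ∑ j, Real.exp (-Ψ j / β) :=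
    Finset.sum_pos (fun _ _ => Real.exp_pos _) ⟨i, Finset.mem_univ i⟩
  rw [gibbs, Real.log_div (Real.exp_pos _).ne' h.ne', Real.log_exp]

/-- Differences of the chemical potential are differences of `β log (ρ / ρ*)`. -/
theorem chemical_potential_sub {N : ℕ} (Ψ : Fin N → ℝ) {β : ℝ} (hβ : β ≠ 0) {ρ : Fin N → ℝ}
    (hρ : ∀ i, 0 < ρ i) (i j : Fin N) :
    (Ψ j + β * Real.log (ρ j)) - (Ψ i + β * Real.log (ρ i)) =
      β * (Real.log (ρ j / gibbs Ψ β j) - Real.log (ρ i / gibbs Ψ β i)) := by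
  rw [Real.log_div (hρ j).ne' (gibbs_pos Ψ β j).ne',
    Real.log_div (hρ i).ne' (gibbs_pos Ψ β i).ne', log_gibbs, log_gibbs]
  field_simp
  ring

/-- The upwind flux along an edge for the log-density `log (ρ / ρ*)`. -/
noncomputable def upwindFlux {N : ℕ} (G : SimpleGraph (Fin N)) [DecidableRel G.Adj]
    (β : ℝ) (L ρ : Fin N → ℝ) (i j : Fin N) : ℝ :=
  if G.Adj i j then β * (L j - L i) * (if L i < L j then ρ j else ρ i) else 0

theorem upwindFlux_antisymm {N : ℕ} (G : SimpleGraph (Fin N)) [DecidableRel G.Adj]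
    (β : ℝ) (L ρ : Fin N → ℝ) (i j : Fin N) :
    upwindFlux G β L ρ i j = -upwindFlux G β L ρ j i := by
  unfold upwindFlux
  simp only [G.adj_comm j i]
  split_ifs with h h1 h2 h2
  · exact absurd h1 h2.asymm
  · ring
  · ring
  · rw [le_antisymm (not_lt.mp h1) (not_lt.mp h2)]
    ring
  · ring

theorem fpe2RHS_eq_sum_upwindFlux {N : ℕ} (G : SimpleGraph (Fin N)) [DecidableRel G.Adj]
    (Ψ : Fin N → ℝ) {β : ℝ} (hβ : 0 < β) {ρ : Fin N → ℝ} (hρ : ∀ i, 0 < ρ i) (i : Fin N) :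
    fpe2RHS G Ψ β ρ i =
      ∑ j, upwindFlux G β (fun k => Real.log (ρ k / gibbs Ψ β k)) ρ i j := by
  unfold fpe2RHS upwindFlux
  rw [← Finset.sum_add_distrib]
  refine Finset.sum_congr rfl fun j _ => ?_
  have lt_iff (a b : Fin N) : Ψ a + β * Real.log (ρ a) < Ψ b + β * Real.log (ρ b) ↔
      Real.log (ρ a / gibbs Ψ β a) < Real.log (ρ b / gibbs Ψ β b) := by
    rw [← sub_pos, chemical_potential_sub Ψ hβ.ne' hρ, mul_pos_iff_of_pos_left hβ, sub_pos]
  simp only [lt_iff, chemical_potential_sub Ψ hβ.ne' hρ]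
  by_cases h : G.Adj i j
  · rcases lt_trichotomy (Real.log (ρ i / gibbs Ψ β i)) (Real.log (ρ j / gibbs Ψ β j))
      with h' | h' | h'
    · simp [h, h', h'.asymm]
    · simp [h, h']
    · simp [h, h', h'.asymm]
  · simp [h]

theorem hasDerivAt_relEnt {N : ℕ} {ρ : ℝ → Fin N → ℝ} {ρ' μ : Fin N → ℝ} {t : ℝ}
    (hρ : ∀ i, 0 < ρ t i) (hμ : ∀ i, 0 < μ i)
    (h : ∀ i, HasDerivAt (fun s => ρ s i) (ρ' i) t) :
    HasDerivAt (fun s => relEnt (ρ s) μ) (∑ i, ρ' i * (Real.log (ρ t i / μ i) + 1)) t := by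
  unfold relEnt
  refine HasDerivAt.fun_sum fun i _ => ?_
  have h0 := (hρ i).ne'
  have hm := (hμ i).ne'
  refine ((h i).mul (((h i).div_const (μ i)).log (div_ne_zero h0 hm))).congr_deriv ?_
  field_simp

/-- The edgewise comparison for `x ≤ y`, from `1 - x / y ≤ log (y / x)`. -/
theorem log_sub_mul_sub_mul_le {x y c d : ℝ} (hx : 0 < x) (hxy : x ≤ y)
    (hd : 0 ≤ d) (hcd : c ≤ d) :
    c * ((Real.log y - Real.log x) * (y - x)) ≤
      (Real.log y - Real.log x) ^ 2 * (y * d) := by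
  have hy := hx.trans_le hxy
  have hl : 0 ≤ Real.log y - Real.log x := sub_nonneg.2 (Real.log_le_log hx hxy)
  have key : y - x ≤ y * (Real.log y - Real.log x) := by
    have := Real.one_sub_inv_le_log_of_pos (div_pos hy hx)
    rw [Real.log_div hy.ne' hx.ne', inv_div] at this
    have h := mul_le_mul_of_nonneg_left this hy.le
    have e : y * (1 - x / y) = y - x := by field_simp
    rwa [e] at h
  calc c * ((Real.log y - Real.log x) * (y - x))
      ≤ d * ((Real.log y - Real.log x) * (y - x)) :=
        mul_le_mul_of_nonneg_right hcd (mul_nonneg hl (sub_nonneg.2 hxy))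
    _ ≤ d * ((Real.log y - Real.log x) * (y * (Real.log y - Real.log x))) := by gcongr
    _ = _ := by ring

theorem upwindFlux_mul_le {N : ℕ} (G : SimpleGraph (Fin N)) [DecidableRel G.Adj]
    {β c : ℝ} (hβ : 0 < β) {f μ : Fin N → ℝ} (hf : ∀ i, 0 < f i) (hμ : ∀ i, 0 < μ i)
    (hc : ∀ i j, c * μ i ≤ μ j) (i j : Fin N) :
    upwindFlux G β (fun k => Real.log (f k)) (fun k => f k * μ k) i j *
        (Real.log (f i) - Real.log (f j)) ≤
      -β * c * (if G.Adj i j then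
        (Real.log (f i) - Real.log (f j)) * (f i - f j) * μ i else 0) := by
  unfold upwindFlux
  split_ifs with h hlt
  · have hle := ((Real.log_lt_log_iff (hf i) (hf j)).1 hlt).le
    have := mul_le_mul_of_nonneg_left
      (log_sub_mul_sub_mul_le (hf i) hle (hμ j).le (hc i j)) hβ.le
    linarith
  · have hle := (Real.log_le_log_iff (hf j) (hf i)).1 (not_lt.1 hlt)
    have := mul_le_mul_of_nonneg_left
      (log_sub_mul_sub_mul_le (hf j) hle (hμ i).le (hc i i)) hβ.le
    linarith
  · simp

theorem iInf_div_iSup_mul_le {ι : Type*} [Finite ι] {μ : ι → ℝ} (hμ : ∀ i, 0 < μ i) (i j : ι) :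
    ((⨅ k, μ k) / ⨆ k, μ k) * μ i ≤ μ j := by
  have hsup : μ i ≤ ⨆ k, μ k := le_ciSup (Set.finite_range μ).bddAbove i
  have hinf : ⨅ k, μ k ≤ μ j := ciInf_le (Set.finite_range μ).bddBelow j
  have h0 : 0 ≤ ⨅ k, μ k := Real.iInf_nonneg fun k => (hμ k).le
  have hpos := (hμ i).trans_le hsup
  rw [div_mul_eq_mul_div, div_le_iff₀ hpos]
  exact mul_le_mul hinf hsup (hμ i).le (hμ j).le

theorem fpe2_entropy_dissipation_bound {N : ℕ} (hN : 2 ≤ N)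
    (G : SimpleGraph (Fin N)) [DecidableRel G.Adj] (hG : G.Connected)
    (Ψ : Fin N → ℝ) (β : ℝ) (hβ : 0 < β)
    (ρ : ℝ → Fin N → ℝ) (hsol : IsFPE2Sol G Ψ β ρ) :
    ∀ t, 0 < t →
      deriv (fun s => relEnt (ρ s) (gibbs Ψ β)) t ≤
        -(β / 2) * ((⨅ i, gibbs Ψ β i) / (⨆ i, gibbs Ψ β i)) *
          dirichletForm G (gibbs Ψ β) (fun i => ρ t i / gibbs Ψ β i) := by
  intro t ht
  have hρ := (hsol.1 t ht.le).1
  have hμ := gibbs_pos Ψ β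
  have hd (i : Fin N) : HasDerivAt (fun s => ρ s i) (fpe2RHS G Ψ β (ρ t) i) t :=
    (hsol.2 t ht.le i).hasDerivAt (Ici_mem_nhds ht)
  rw [(hasDerivAt_relEnt hρ hμ hd).deriv]
  simp_rw [fpe2RHS_eq_sum_upwindFlux G Ψ hβ hρ]
  rw [sum_mul_sum_of_antisymm _ (upwindFlux_antisymm G β _ _)]
  simp only [add_sub_add_right_eq_sub]
  set c := (⨅ i, gibbs Ψ β i) / ⨆ i, gibbs Ψ β i
  have hfμ : ρ t = fun k => ρ t k / gibbs Ψ β k * gibbs Ψ β k :=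
    funext fun k => (div_mul_cancel₀ _ (hμ k).ne').symm
  have hedge (i j : Fin N) := upwindFlux_mul_le G hβ (fun k => div_pos (hρ k) (hμ k)) hμ
    (iInf_div_iSup_mul_le hμ) i j
  simp_rw [← congrFun hfμ] at hedge
  have := Finset.sum_le_sum fun i (_ : i ∈ Finset.univ) =>
    Finset.sum_le_sum fun j (_ : j ∈ Finset.univ) => hedge i j
  simp_rw [← Finset.mul_sum] at this
  unfold dirichletForm
  linarith
end
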